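/- arXiv:1704.07811 — 2 statements merged into one kernel-verified Lean document; each statement's English description precedes it below -/
import Mathlib

section
/- Let J be a quadratic Jordan algebra arising from a cubic norm structure (N, #, c) over a field k, and define U_a(y) = T(a,y)a − a^# × y. If a ∈ J is invertible (i.e., N(a) ≠ 0), then N(U_a(x)) = N(a)^2 · N(x) for all x ∈ J; in particular U_a is a norm similarity with similitude factor N(a)^2. -/
/-- A cubic norm structure `(N, #, c)` on a finite-dimensional `k`-vector space `J`:
a base point `c` with `N c = 1`, a nondegenerate trace bilinear form `T`,
and a quadratic adjoint `#` satisfying the directional-derivative expansion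
`N (x + t•y) = N x + t·T(x^#,y) + t²·T(x,y^#) + t³·N y`, the adjoint identity
`x^{##} = N(x)·x`, `c^# = c`, and `c × x = T(x)·c − x`. -/
structure CubicNorm (k J : Type*) [Field k] [AddCommGroup J] [Module k J] where
  c : J
  N : J → k
  T : J →ₗ[k] J →ₗ[k] k
  sharp : J → J
  base : N c = 1
  expand : ∀ (t : k) (x y : J),
    N (x + t • y) = N x + t * T (sharp x) y + t ^ 2 * T x (sharp y) + t ^ 3 * N y
  nondeg : ∀ x, (∀ y, T x y = 0) → x = 0
  sharp_smul : ∀ (t : k) (x : J), sharp (t • x) = t ^ 2 • sharp x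
  adjoint : ∀ x, sharp (sharp x) = N x • x
  sharp_c : sharp c = c
  cross_c : ∀ x, sharp (c + x) - sharp c - sharp x = T x c • c - x

namespace CubicNorm

variable {k J : Type*} [Field k] [AddCommGroup J] [Module k J]

/-- The Freudenthal cross product `x × y = (x+y)^# − x^# − y^#`. -/
def cross (S : CubicNorm k J) (x y : J) : J :=
  S.sharp (x + y) - S.sharp x - S.sharp y

/-- The `U`-operator `U_a(y) = T(a,y)·a − a^# × y`. -/
def U (S : CubicNorm k J) (a y : J) : J :=
  S.T a y • a - S.cross (S.sharp a) y

end CubicNorm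

namespace CubicNorm

variable {k J : Type*} [Field k] [AddCommGroup J] [Module k J] (S : CubicNorm k J)

theorem ext_T {x y : J} (h : ∀ z, S.T x z = S.T y z) : x = y := by
  refine sub_eq_zero.1 (S.nondeg _ fun z => ?_)
  rw [map_sub, LinearMap.sub_apply, h z, sub_self]

theorem sharp_zero : S.sharp 0 = 0 := by
  simpa using S.sharp_smul 0 0

theorem N_zero : S.N 0 = 0 := by
  have h := S.expand 1 0 0
  simp only [S.sharp_zero, map_zero, smul_zero, add_zero] at h
  linear_combination -h

theorem N_smul (t : k) (x : J) : S.N (t • x) = t ^ 3 * S.N x := by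
  have h := S.expand t 0 x
  simp only [S.sharp_zero, S.N_zero, map_zero, LinearMap.zero_apply, zero_add] at h
  linear_combination h

theorem N_add (x y : J) :
    S.N (x + y) = S.N x + S.T (S.sharp x) y + S.T x (S.sharp y) + S.N y := by
  have h := S.expand 1 x y
  rw [one_smul] at h
  linear_combination h

theorem c_ne_zero : S.c ≠ 0 := by
  intro h
  have := S.base
  rw [h, S.N_zero] at this
  exact zero_ne_one this

theorem sharp_add (x y : J) : S.sharp (x + y) = S.sharp x + S.sharp y + S.cross x y := by
  unfold cross
  abel

theorem cross_comm (x y : J) : S.cross x y = S.cross y x := by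
  unfold cross
  rw [add_comm x y]
  abel

theorem cross_base_left (x : J) : S.cross S.c x = S.T x S.c • S.c - x := S.cross_c x

/-- The trace form is symmetric. -/
theorem T_comm (x y : J) : S.T x y = S.T y x := by
  have hs (x y : J) : S.T (S.sharp x) y - S.T y (S.sharp x)
      = -(S.T x (S.sharp y) - S.T (S.sharp y) x) := by
    have h := S.N_add x y
    rw [add_comm x y, S.N_add y x] at h
    linear_combination -h
  have hc (x y : J) : S.T x y - S.T y x = S.T x S.c * (S.T S.c y - S.T y S.c) := by
    have e := S.cross_base_left x
    have e₁ := congrArg (fun z => S.T z y) e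
    have e₂ := congrArg (fun z => S.T y z) e
    simp only [cross, map_sub, map_smul, LinearMap.sub_apply, LinearMap.smul_apply,
      smul_eq_mul] at e₁ e₂
    have h₁ := hs (S.c + x) y
    have h₂ := hs S.c y
    have h₃ := hs x y
    simp only [map_add, LinearMap.add_apply] at h₁
    linear_combination e₁ - e₂ - h₁ + h₂ + h₃
  have h₁ := hc x y
  have h₂ := hc y S.c
  rw [sub_self, mul_zero] at h₂
  linear_combination h₁ - S.T x S.c * h₂

theorem T_cross_assoc (x y z : J) : S.T (S.cross x y) z = S.T x (S.cross y z) := by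
  have h := S.N_add (x + y) z
  rw [add_assoc, S.N_add x (y + z), S.N_add y z, S.N_add x y, S.sharp_add, S.sharp_add] at h
  simp only [map_add, LinearMap.add_apply] at h
  linear_combination -h

theorem cross_add_left (x y z : J) : S.cross (x + y) z = S.cross x z + S.cross y z := by
  refine S.ext_T fun w => ?_
  simp only [map_add, LinearMap.add_apply, T_cross_assoc]

theorem cross_smul_left (t : k) (x y : J) : S.cross (t • x) y = t • S.cross x y := by
  refine S.ext_T fun w => ?_
  simp only [map_smul, LinearMap.smul_apply, T_cross_assoc]

/-- The cross product as a bilinear map. -/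
def crossₗ : J →ₗ[k] J →ₗ[k] J :=
  LinearMap.mk₂ k S.cross S.cross_add_left S.cross_smul_left
    (fun x y z => by rw [S.cross_comm, cross_add_left, S.cross_comm y, S.cross_comm z])
    (fun t x y => by rw [S.cross_comm, cross_smul_left, S.cross_comm y])

theorem crossₗ_apply (x y : J) : S.crossₗ x y = S.cross x y := rfl

theorem crossₗ_comm (x y : J) : S.crossₗ x y = S.crossₗ y x := S.cross_comm x y

theorem T_crossₗ (x y z : J) : S.T (S.crossₗ x y) z = S.T x (S.crossₗ y z) :=
  S.T_cross_assoc x y z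

/-- `x × ·` is self-adjoint for the trace form. -/
theorem T_crossₗ_left (x y z : J) : S.T (S.crossₗ x y) z = S.T y (S.crossₗ x z) := by
  rw [S.crossₗ_comm, T_crossₗ]

theorem sharp_add' (x y : J) : S.sharp (x + y) = S.sharp x + S.sharp y + S.crossₗ x y :=
  S.sharp_add x y

theorem sharp_neg (x : J) : S.sharp (-x) = S.sharp x := by
  simpa using S.sharp_smul (-1) x

theorem crossₗ_self (x : J) : S.crossₗ x x = (2 : k) • S.sharp x := by
  have h := S.sharp_smul 2 x
  rw [two_smul, S.sharp_add'] at h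
  linear_combination (norm := module) h

theorem crossₗ_base (x : J) : S.crossₗ x S.c = S.T x S.c • S.c - x := by
  rw [S.crossₗ_comm]
  exact S.cross_base_left x

theorem base_crossₗ (x : J) : S.crossₗ S.c x = S.T x S.c • S.c - x :=
  S.cross_base_left x

theorem T_base_base : S.T S.c S.c = 3 := by
  have h := S.crossₗ_self S.c
  rw [S.crossₗ_base, S.sharp_c] at h
  have h' : (S.T S.c S.c - 3) • S.c = 0 := by linear_combination (norm := module) h
  exact sub_eq_zero.1 ((smul_eq_zero.1 h').resolve_right S.c_ne_zero)

theorem T_crossₗ_base (x y : J) :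
    S.T (S.crossₗ x y) S.c = S.T x S.c * S.T y S.c - S.T x y := by
  rw [T_crossₗ, crossₗ_base, map_sub, map_smul, smul_eq_mul]
  ring

/-- The sum of the mixed terms in the expansion of `(x + y)^{##} = N(x + y)(x + y)`. -/
theorem adjoint_add (x y : J) :
    S.sharp (S.crossₗ x y) + S.crossₗ (S.sharp x) (S.sharp y)
      + S.crossₗ (S.sharp x) (S.crossₗ x y) + S.crossₗ (S.sharp y) (S.crossₗ x y)
    = S.N x • y + S.N y • x + (S.T (S.sharp x) y + S.T x (S.sharp y)) • (x + y) := by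
  have h := S.adjoint (x + y)
  rw [sharp_add', sharp_add', sharp_add', adjoint, adjoint, N_add] at h
  simp only [map_add, LinearMap.add_apply] at h
  linear_combination (norm := module) h

theorem crossₗ_sharp (x : J) :
    S.crossₗ x (S.sharp x) = (S.T x S.c * S.T (S.sharp x) S.c - S.N x) • S.c
      - S.T (S.sharp x) S.c • x - S.T x S.c • S.sharp x := by
  have h := S.adjoint_add x S.c
  have hx : S.sharp (S.T x S.c • S.c - x) = S.T x S.c • x + S.sharp x := by
    rw [sub_eq_add_neg, sharp_add', sharp_neg, sharp_smul, sharp_c, map_smul, map_neg,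
      LinearMap.smul_apply, base_crossₗ]
    module
  rw [crossₗ_base, hx] at h
  simp only [sharp_c, crossₗ_base, base_crossₗ, map_sub, map_smul, base, T_base_base] at h
  rw [S.crossₗ_comm (S.sharp x) x] at h
  linear_combination (norm := module) -h

theorem T_sharp_self (x : J) : S.T (S.sharp x) x = 3 * S.N x := by
  have h := congrArg (fun z => S.T z S.c) (S.crossₗ_sharp x)
  simp only [T_crossₗ_base, map_sub, map_smul, LinearMap.sub_apply, LinearMap.smul_apply,
    smul_eq_mul, T_base_base] at h
  linear_combination S.T_comm (S.sharp x) x - h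

/-- The part of the expansion of `adjoint` at `x + y + z` of degree `(2, 1, 1)`. -/
def adjointPolar (x y z : J) : J :=
  S.crossₗ (S.crossₗ x y) (S.crossₗ x z) + S.crossₗ (S.sharp x) (S.crossₗ y z)
    - S.T (S.sharp x) y • z - S.T (S.sharp x) z • y - S.T x (S.crossₗ y z) • x

theorem adjointPolar_comm (x y z : J) : S.adjointPolar x y z = S.adjointPolar x z y := by
  unfold adjointPolar
  rw [S.crossₗ_comm y z, S.crossₗ_comm (S.crossₗ x y)]
  abel

theorem adjointPolar_cyclic (x y z : J) :
    S.adjointPolar x y z + S.adjointPolar y z x + S.adjointPolar z x y = 0 := by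
  have h₁ := S.adjoint_add x (y + z)
  have h₂ := S.adjoint_add x y
  have h₃ := S.adjoint_add x z
  simp only [sharp_add', N_add, map_add, LinearMap.add_apply] at h₁
  unfold adjointPolar
  have t₁ : S.T y (S.crossₗ z x) = S.T x (S.crossₗ y z) := by
    rw [S.crossₗ_comm z x, S.T_comm, T_crossₗ, S.crossₗ_comm z y]
  have t₂ : S.T z (S.crossₗ x y) = S.T x (S.crossₗ y z) := by
    rw [S.T_comm, T_crossₗ]
  rw [t₁, t₂, S.crossₗ_comm z x, S.crossₗ_comm y x, S.crossₗ_comm z y,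
    S.T_comm (S.sharp y) x, S.T_comm (S.sharp z) x, S.T_comm (S.sharp z) y,
    S.crossₗ_comm (S.crossₗ x z) (S.crossₗ y z)]
  linear_combination (norm := module) h₁ - h₂ - h₃

/-- The linearization of `crossₗ_sharp`; equivalently
`(x × ·)² = -(x^# × ·) - T(x)(x × ·) - T(x^#) id` up to rank one terms. -/
def crossSq (x y : J) : J :=
  S.crossₗ x (S.crossₗ x y) + S.crossₗ (S.sharp x) y
    - (S.T x S.c * (S.T x S.c * S.T y S.c - S.T x y) + S.T y S.c * S.T (S.sharp x) S.c
      - S.T (S.sharp x) y) • S.c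
    + S.T (S.sharp x) S.c • y + (S.T x S.c * S.T y S.c - S.T x y) • x
    + S.T y S.c • S.sharp x + S.T x S.c • S.crossₗ x y

theorem crossSq_swap (x y : J) : S.crossSq x y = -S.crossSq y x := by
  have h := S.crossₗ_sharp (x + y)
  have h₁ := S.crossₗ_sharp x
  have h₂ := S.crossₗ_sharp y
  simp only [sharp_add', N_add, map_add, LinearMap.add_apply, T_crossₗ_base] at h
  rw [S.crossₗ_comm x (S.sharp y)] at h
  unfold crossSq
  rw [S.crossₗ_comm y x, S.T_comm y x, S.T_comm (S.sharp y) x]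
  rw [S.crossₗ_comm y (S.sharp x)] at h
  linear_combination (norm := module) h - h₁ - h₂

theorem T_crossSq (x y z : J) : S.T (S.crossSq x y) z = S.T (S.crossSq x z) y := by
  unfold crossSq
  simp only [map_add, map_sub, map_smul, LinearMap.add_apply, LinearMap.sub_apply,
    LinearMap.smul_apply, smul_eq_mul, S.T_comm S.c]
  linear_combination S.T_crossₗ_left x (S.crossₗ x y) z + S.T_comm (S.crossₗ x y) (S.crossₗ x z)
    - S.T_crossₗ_left x (S.crossₗ x z) y + S.T_crossₗ_left (S.sharp x) y z
    + S.T_comm y (S.crossₗ (S.sharp x) z)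
    + S.T (S.sharp x) S.c * S.T_comm y z
    + S.T x S.c * (S.T_crossₗ_left x y z + S.T_comm y (S.crossₗ x z))

theorem T_adjointPolar_base (x y z : J) :
    S.T (S.adjointPolar x y z) S.c = -S.T (S.crossSq x y) z := by
  unfold crossSq adjointPolar
  simp only [map_add, map_sub, map_smul, LinearMap.add_apply, LinearMap.sub_apply,
    LinearMap.smul_apply, smul_eq_mul, T_crossₗ_base, S.T_comm S.c]
  linear_combination S.T_crossₗ_left x (S.crossₗ x y) z + S.T_crossₗ (S.sharp x) y z
    + S.T x S.c * S.T_crossₗ x y z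

theorem crossSq_eq_zero (x y : J) : S.crossSq x y = 0 := by
  refine S.nondeg _ fun z => ?_
  have h := congrArg (fun w => S.T w S.c) (S.adjointPolar_cyclic x y z)
  have hn (x y z : J) : S.T (S.crossSq x y) z = -S.T (S.crossSq y x) z := by
    rw [crossSq_swap, map_neg, LinearMap.neg_apply]
  simp only [map_add, LinearMap.add_apply, T_adjointPolar_base, map_zero,
    LinearMap.zero_apply] at h
  linear_combination h + S.T_crossSq y z x + hn y x z + hn z x y - S.T_crossSq x z y

theorem crossₗ_crossₗ (x y : J) :
    S.crossₗ x (S.crossₗ x y) = -S.crossₗ (S.sharp x) y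
      + (S.T x S.c * (S.T x S.c * S.T y S.c - S.T x y) + S.T y S.c * S.T (S.sharp x) S.c
        - S.T (S.sharp x) y) • S.c
      - S.T (S.sharp x) S.c • y - (S.T x S.c * S.T y S.c - S.T x y) • x
      - S.T y S.c • S.sharp x - S.T x S.c • S.crossₗ x y := by
  have h := S.crossSq_eq_zero x y
  unfold crossSq at h
  linear_combination (norm := module) h

/-- The Jacobi-like identity obtained by linearizing `crossₗ_crossₗ`. -/
theorem crossₗ_jacobi (x y z : J) :
    S.crossₗ x (S.crossₗ z y) + S.crossₗ z (S.crossₗ x y) + S.crossₗ (S.crossₗ x z) y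
      = (S.T x S.c * (S.T z S.c * S.T y S.c - S.T z y)
          + S.T z S.c * (S.T x S.c * S.T y S.c - S.T x y)
          + S.T y S.c * (S.T x S.c * S.T z S.c - S.T x z) - S.T (S.crossₗ x z) y) • S.c
        - (S.T x S.c * S.T z S.c - S.T x z) • y - (S.T x S.c * S.T y S.c - S.T x y) • z
        - (S.T z S.c * S.T y S.c - S.T z y) • x
        - S.T y S.c • S.crossₗ x z - S.T x S.c • S.crossₗ z y - S.T z S.c • S.crossₗ x y := by
  have h := S.crossₗ_crossₗ (x + z) y
  have h₁ := S.crossₗ_crossₗ x y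
  have h₂ := S.crossₗ_crossₗ z y
  simp only [sharp_add', map_add, LinearMap.add_apply, T_crossₗ_base] at h
  linear_combination (norm := module) h - h₁ - h₂

theorem T_adjointPolar_swap (x y z w : J) :
    S.T (S.adjointPolar x y z) w = S.T (S.adjointPolar x y w) z := by
  have s₁ (z w : J) := congrArg (fun v => S.T v (S.crossₗ y z)) (S.crossₗ_crossₗ x w)
  have s₂ (z w : J) := congrArg (fun v => S.T v (S.crossₗ x w)) (S.crossₗ_jacobi x y z)
  have s₃ (z : J) := congrArg (fun v => S.T v y) (S.crossₗ_crossₗ x z)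
  have r₂ (z w : J) : S.T (S.crossₗ (S.sharp x) (S.crossₗ y z)) w
      = S.T (S.crossₗ (S.sharp x) w) (S.crossₗ y z) := by
    rw [T_crossₗ_left, S.T_comm]
  have r₃ (z w : J) : S.T (S.crossₗ x (S.crossₗ z y)) (S.crossₗ x w)
      = S.T (S.crossₗ x (S.crossₗ x w)) (S.crossₗ y z) := by
    rw [T_crossₗ_left, S.T_comm, S.crossₗ_comm z y]
  have r₄ (z w : J) : S.T (S.crossₗ (S.crossₗ x y) (S.crossₗ x z)) w
      = S.T (S.crossₗ w (S.crossₗ x y)) (S.crossₗ x z) := by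
    rw [S.crossₗ_comm w, T_crossₗ_left, S.T_comm]
  have r₅ : S.T (S.crossₗ x z) (S.crossₗ y (S.crossₗ x w))
      = S.T (S.crossₗ x w) (S.crossₗ y (S.crossₗ x z)) := by
    rw [S.T_comm, T_crossₗ_left]
  have r₆ (z : J) : S.T (S.sharp x) (S.crossₗ y z) = S.T (S.crossₗ (S.sharp x) z) y := by
    rw [S.crossₗ_comm y, T_crossₗ]
  have r₇ (z : J) : S.T (S.crossₗ x (S.crossₗ x z)) y = S.T (S.crossₗ x y) (S.crossₗ x z) := by
    rw [T_crossₗ_left, S.T_comm]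
  have r₈ : S.T (S.crossₗ x z) (S.crossₗ x w) = S.T (S.crossₗ x w) (S.crossₗ x z) :=
    S.T_comm _ _
  have r₉ (z : J) : S.T x (S.crossₗ x z) = 2 * S.T (S.sharp x) z := by
    rw [← T_crossₗ, crossₗ_self, map_smul, LinearMap.smul_apply, smul_eq_mul]
  have p₁ (z : J) : S.T (S.crossₗ x z) y = S.T x (S.crossₗ y z) := by
    rw [T_crossₗ, S.crossₗ_comm]
  have p₃ (z : J) : S.T y (S.crossₗ x z) = S.T x (S.crossₗ y z) := by
    rw [S.T_comm, T_crossₗ, S.crossₗ_comm]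
  have p₄ : S.T z (S.crossₗ x w) = S.T w (S.crossₗ x z) := by
    rw [S.T_comm, T_crossₗ_left]
  have p₅ : S.T z (S.crossₗ y w) = S.T w (S.crossₗ y z) := by
    rw [S.T_comm, T_crossₗ_left]
  have p₆ (z w : J) : S.T (S.crossₗ z y) (S.crossₗ x w) = S.T (S.crossₗ x w) (S.crossₗ y z) := by
    rw [S.T_comm, S.crossₗ_comm z]
  unfold adjointPolar
  simp only [map_add, map_sub, map_smul, map_neg, LinearMap.add_apply, LinearMap.sub_apply,
    LinearMap.smul_apply, LinearMap.neg_apply, smul_eq_mul, S.T_comm S.c,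
    T_crossₗ_base, S.T_comm w z,
    r₂, r₃, r₄, r₆, r₇, r₉, p₁, p₃, p₆] at s₁ s₂ s₃ ⊢
  linear_combination s₁ z w - s₂ z w - s₁ w z + s₂ w z
    - S.T w S.c * s₃ z + S.T z S.c * s₃ w - r₅ + S.T y S.c * r₈
    + (S.T x S.c * S.T y S.c - S.T x y) * p₄ + S.T (S.sharp x) S.c * p₅
    + (S.T x S.c ^ 2 * S.T z S.c - S.T x S.c * S.T x z - 2 * S.T (S.sharp x) z
      + S.T (S.sharp x) S.c * S.T z S.c) * S.T_comm y w
    - (S.T x S.c ^ 2 * S.T w S.c - S.T x S.c * S.T x w - 2 * S.T (S.sharp x) w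
      + S.T (S.sharp x) S.c * S.T w S.c) * S.T_comm y z

theorem adjointPolar_eq_zero (x y z : J) : S.adjointPolar x y z = 0 := by
  have hneg (x y z : J) : S.adjointPolar (-x) y z = S.adjointPolar x y z := by
    simp only [adjointPolar, sharp_neg, map_neg, LinearMap.neg_apply]
    module
  have hneg' (x y z : J) : S.adjointPolar x (-y) z = -S.adjointPolar x y z := by
    simp only [adjointPolar, map_neg, LinearMap.neg_apply]
    module
  have h₂ : (2 : k) • S.adjointPolar x y z = 0 := by
    have h := S.adjointPolar_cyclic x y z
    have h' := S.adjointPolar_cyclic (-x) y z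
    rw [hneg, S.adjointPolar_comm y z, hneg', hneg'] at h'
    rw [S.adjointPolar_comm y z] at h
    linear_combination (norm := module) h + h'
  refine S.nondeg _ fun w => ?_
  have e₂ := congrArg (fun v => S.T v w) h₂
  have c (x y z w : J) : S.T (S.adjointPolar x y z) w + S.T (S.adjointPolar y z x) w
      + S.T (S.adjointPolar z x y) w = 0 := by
    have := congrArg (fun v => S.T v w) (S.adjointPolar_cyclic x y z)
    simpa only [map_add, LinearMap.add_apply, map_zero, LinearMap.zero_apply] using this
  have p (x y z w : J) : S.T (S.adjointPolar x y z) w = S.T (S.adjointPolar x z y) w := by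
    rw [adjointPolar_comm]
  have t := S.T_adjointPolar_swap
  simp only [map_smul, LinearMap.smul_apply, smul_eq_mul, map_zero, LinearMap.zero_apply] at e₂
  have c₁ := c x y z w
  have c₂ := c x y w z
  have c₃ := c x z w y
  have c₄ := c y z w x
  have x₁ := t x y z w
  have x₂ := t x z y w
  have x₃ := p x y z w
  have x₄ := p x w y z
  have x₅ := p x w z y
  grind

theorem T_sharp_crossₗ_crossₗ (x y z : J) :
    S.T (S.crossₗ (S.sharp x) (S.crossₗ x y)) z - S.T (S.sharp x) y * S.T x z
      = S.T (S.crossₗ (S.sharp x) (S.crossₗ x z)) y - S.T (S.sharp x) z * S.T x y := by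
  have h (y z : J) := congrArg (fun w => S.T w z) (S.crossₗ_crossₗ x (S.crossₗ x y))
  have r₁ (y z : J) : S.T (S.crossₗ x (S.crossₗ x y)) z = S.T (S.crossₗ x (S.crossₗ x z)) y := by
    rw [T_crossₗ_left, S.T_comm, S.T_crossₗ_left x (S.crossₗ x z)]
  have r₂ : S.T (S.crossₗ x (S.crossₗ x (S.crossₗ x y))) z
      = S.T (S.crossₗ x (S.crossₗ x (S.crossₗ x z))) y := by
    rw [r₁, S.T_comm, T_crossₗ_left, S.T_comm]
  have r₃ (y : J) : S.T x (S.crossₗ x y) = 2 * S.T (S.sharp x) y := by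
    rw [← T_crossₗ, crossₗ_self, map_smul, LinearMap.smul_apply, smul_eq_mul]
  have r₄ (y : J) : S.T (S.sharp x) (S.crossₗ x y) = S.T (S.crossₗ x (S.sharp x)) y := by
    rw [S.T_crossₗ_left]
  have r₅ : S.T (S.crossₗ x y) z = S.T (S.crossₗ x z) y := by
    rw [T_crossₗ_left, S.T_comm]
  have h₁ := h y z
  have h₂ := h z y
  simp only [map_add, map_sub, map_smul, map_neg, LinearMap.add_apply, LinearMap.sub_apply,
    LinearMap.smul_apply, LinearMap.neg_apply, smul_eq_mul, S.T_comm S.c,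
    T_crossₗ_base, r₃, r₄, crossₗ_sharp] at h₁ h₂
  linear_combination h₁ - h₂ - r₂ - S.T x S.c * r₁ y z - S.T (S.sharp x) S.c * r₅

/-- `x^# × (x × y) = N(x) y + T(x^#, y) x`. -/
theorem sharp_crossₗ_crossₗ (x y : J) :
    S.crossₗ (S.sharp x) (S.crossₗ x y) = S.N x • y + S.T (S.sharp x) y • x := by
  have h₃ (x y z : J) := congrArg (fun w => S.T w z) (S.adjointPolar_eq_zero x x y)
  have h₂ (x y z : J) := congrArg (fun w => S.T w z) (S.adjointPolar_eq_zero x y y)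
  have h (x y z : J) := congrArg (fun w => S.T w z) (S.adjoint_add x y)
  have r (x y : J) : S.T x (S.crossₗ x y) = 2 * S.T (S.sharp x) y := by
    rw [← T_crossₗ, crossₗ_self, map_smul, LinearMap.smul_apply, smul_eq_mul]
  simp only [adjointPolar, crossₗ_self, map_add, map_sub, map_smul, LinearMap.add_apply,
    LinearMap.sub_apply, LinearMap.smul_apply, smul_eq_mul, map_zero, LinearMap.zero_apply,
    T_sharp_self, r] at h h₂ h₃
  have s := S.T_sharp_crossₗ_crossₗ
  obtain ⟨g, hg⟩ : ∃ g : J → J → J → k, ∀ x y z, g x y z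
      = S.T (S.crossₗ (S.sharp x) (S.crossₗ x y)) z - S.N x * S.T y z
        - S.T (S.sharp x) y * S.T x z := ⟨_, fun _ _ _ => rfl⟩
  have g₃ (x y z : J) : 3 * g x y z = 0 := by
    linear_combination h₃ x y z + 3 * hg x y z
  have gs (x y z : J) : g x y z = g x z y := by
    linear_combination s x y z + hg x y z - hg x z y - S.N x * S.T_comm y z
  have ga (x y z : J) : 2 * g x y z = -2 * g y x z := by
    have := h x y z
    have h₂ := h₂ x y z
    have e := hg y x z
    rw [S.crossₗ_comm y x, S.T_comm (S.sharp y) x] at e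
    linear_combination 2 * this - h₂ + 2 * hg x y z + 2 * e
  refine S.ext_T fun z => ?_
  have g₀ : g x y z = 0 := by
    linear_combination -g₃ x y z + 2 * gs x y z + ga x z y - 2 * gs z x y - ga z y x
      + 2 * gs y z x + ga y x z
  simp only [map_add, map_smul, LinearMap.add_apply, LinearMap.smul_apply, smul_eq_mul]
  linear_combination g₀ - hg x y z

/-- `x × (x^# × y) = N(x) y + T(x, y) x^#`. -/
theorem crossₗ_sharp_crossₗ (x y : J) :
    S.crossₗ x (S.crossₗ (S.sharp x) y) = S.N x • y + S.T x y • S.sharp x := by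
  refine S.ext_T fun z => ?_
  have h := congrArg (fun w => S.T w y) (S.sharp_crossₗ_crossₗ x z)
  simp only [map_add, map_smul, LinearMap.add_apply, LinearMap.smul_apply, smul_eq_mul] at h ⊢
  rw [T_crossₗ_left] at h
  rw [T_crossₗ_left, S.T_comm]
  linear_combination h + S.N x * S.T_comm z y

/-- `(x × y)^# = T(x^#, y) y + T(x, y^#) x - x^# × y^#`. -/
theorem sharp_crossₗ (x y : J) :
    S.sharp (S.crossₗ x y) = S.T (S.sharp x) y • y + S.T x (S.sharp y) • x
      - S.crossₗ (S.sharp x) (S.sharp y) := by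
  have h := S.adjoint_add x y
  have h₁ := S.sharp_crossₗ_crossₗ x y
  have h₂ := S.sharp_crossₗ_crossₗ y x
  rw [S.crossₗ_comm y x, S.T_comm (S.sharp y) x] at h₂
  linear_combination (norm := module) h - h₁ - h₂

theorem sharp_ne_zero {a : J} (ha : S.N a ≠ 0) : S.sharp a ≠ 0 := by
  intro h0
  have e := S.adjoint a
  rw [h0, sharp_zero] at e
  rcases smul_eq_zero.1 e.symm with h | rfl
  · exact ha h
  · exact ha S.N_zero

/-- `N(p × x) = T(p^#, x) T(p, x^#) - N(p) N(x)`, here for invertible `p`. -/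
theorem N_crossₗ {p : J} (hp : S.N p ≠ 0) (x : J) :
    S.N (S.crossₗ p x) = S.T (S.sharp p) x * S.T p (S.sharp x) - S.N p * S.N x := by
  rcases eq_or_ne (S.crossₗ p x) 0 with h0 | h0
  · have h := S.sharp_crossₗ_crossₗ p x
    rw [h0, map_zero] at h
    obtain ⟨t, rfl⟩ : ∃ t : k, x = t • p := by
      refine ⟨-(S.N p)⁻¹ * S.T (S.sharp p) x, ?_⟩
      have h' : S.N p • (x - (-(S.N p)⁻¹ * S.T (S.sharp p) x) • p) = 0 := by
        rw [smul_sub, smul_smul]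
        have : S.N p * (-(S.N p)⁻¹ * S.T (S.sharp p) x) = -S.T (S.sharp p) x := by
          field_simp
        rw [this]
        linear_combination (norm := module) -h
      exact sub_eq_zero.1 ((smul_eq_zero.1 h').resolve_left hp)
    have h2 : 2 * t = 0 := by
      rw [map_smul, crossₗ_self, smul_smul] at h0
      rw [mul_comm]
      exact (smul_eq_zero.1 h0).resolve_right (S.sharp_ne_zero hp)
    rw [h0, N_zero, N_smul, sharp_smul, map_smul, map_smul, S.T_comm p, T_sharp_self]
    simp only [smul_eq_mul]
    linear_combination -4 * t ^ 2 * S.N p ^ 2 * h2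
  · have h := S.adjoint (S.crossₗ p x)
    have h₁ := S.crossₗ_sharp_crossₗ x (S.sharp p)
    have h₂ := S.crossₗ_sharp_crossₗ p (S.sharp x)
    rw [sharp_crossₗ, sub_eq_add_neg, sharp_add', sharp_neg, sharp_add', sharp_crossₗ] at h
    simp only [sharp_smul, adjoint, map_add, map_neg, map_smul, LinearMap.add_apply,
      LinearMap.smul_apply, smul_eq_mul, h₂] at h
    rw [S.crossₗ_comm (S.sharp p), h₁, S.crossₗ_comm x p, S.T_comm x (S.sharp p)] at h
    have h' : (S.N (S.crossₗ p x) - (S.T (S.sharp p) x * S.T p (S.sharp x) - S.N p * S.N x))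
        • S.crossₗ p x = 0 := by
      linear_combination (norm := module) -h
    exact sub_eq_zero.1 ((smul_eq_zero.1 h').resolve_right h0)

theorem N_sharp {a : J} (ha : S.N a ≠ 0) : S.N (S.sharp a) = S.N a ^ 2 := by
  have h := congrArg S.sharp (S.adjoint a)
  rw [adjoint, sharp_smul] at h
  have h' : (S.N (S.sharp a) - S.N a ^ 2) • S.sharp a = 0 := by
    linear_combination (norm := module) h
  exact sub_eq_zero.1 ((smul_eq_zero.1 h').resolve_right (S.sharp_ne_zero ha))

/-- `N(U_a x) = N(a)² N(x)` for invertible `a`. -/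
theorem N_U {a : J} (ha : S.N a ≠ 0) (x : J) : S.N (S.U a x) = S.N a ^ 2 * S.N x := by
  have hp : S.N (S.sharp a) ≠ 0 := by
    rw [S.N_sharp ha]
    exact pow_ne_zero 2 ha
  have e : S.U a x = S.T a x • a + (-1 : k) • S.crossₗ (S.sharp a) x := by
    rw [U, crossₗ_apply]
    module
  have h₁ : S.T (S.sharp a) (S.crossₗ (S.sharp a) x) = 2 * S.N a * S.T a x := by
    rw [← T_crossₗ, crossₗ_self, adjoint]
    simp only [map_smul, LinearMap.smul_apply, smul_eq_mul]
    ring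
  have h₂ : S.T a (S.crossₗ a (S.sharp x)) = 2 * S.T (S.sharp a) (S.sharp x) := by
    rw [← T_crossₗ, crossₗ_self]
    simp only [map_smul, LinearMap.smul_apply, smul_eq_mul]
  rw [e, expand, N_crossₗ S hp, N_smul, sharp_smul, sharp_crossₗ, N_sharp S ha]
  simp only [adjoint, map_add, map_sub, map_smul, LinearMap.smul_apply, smul_eq_mul, h₁, h₂,
    S.T_comm a (S.sharp a), T_sharp_self]
  ring

end CubicNorm

/-- In the quadratic Jordan algebra of a cubic norm structure,
if `a` is invertible (`N a ≠ 0`), then `N (U_a x) = N(a)² · N x` for all `x`;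
in particular `U_a` is a norm similarity with factor `N(a)²`. -/
theorem stmt1 {k J : Type*} [Field k] [AddCommGroup J] [Module k J]
    [FiniteDimensional k J] (S : CubicNorm k J) (a : J) (ha : S.N a ≠ 0) :
    ∀ x : J, S.N (S.U a x) = (S.N a) ^ 2 * S.N x :=
  S.N_U ha
end

section
/- Let (B,σ) be a degree 3 central division algebra over its center K, a quadratic étale extension of a field k (possibly of characteristic 2), with σ an involution of the second kind. Then every nonzero g ∈ B admits a factorization g = z·s with s ∈ (B,σ)_+ and z ∈ B^* satisfying z σ(z) = σ(z) z. -/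
/-- Yanchevskii-type factorization, arbitrary characteristic:
Let `B` be a degree 3 central division algebra over its center `K`, a quadratic
étale (here: quadratic field) extension of `k`, with `σ` an involution of the
second kind (restricting on `K` to the nontrivial `k`-automorphism `bar`).
Then every nonzero `g ∈ B` factors as `g = z·s` with `s ∈ (B,σ)₊ = {b | σ b = b}`
and `z ∈ B*` commuting with `σ(z)`. -/
theorem stmt6 {k K B : Type*} [Field k] [Field K] [Algebra k K] [DivisionRing B]
    [Algebra K B] [Algebra k B] [IsScalarTower k K B]
    (hK2 : Module.finrank k K = 2) (hB9 : Module.finrank K B = 9)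
    (hcenter : ∀ b : B, (∀ x : B, b * x = x * b) → ∃ α : K, algebraMap K B α = b)
    (bar : K ≃ₐ[k] K) (hbar : ∀ α, bar (bar α) = α) (hbar_ne : ∃ α, bar α ≠ α)
    (σ : B → B)
    (hσ_add : ∀ x y, σ (x + y) = σ x + σ y)
    (hσ_mul : ∀ x y, σ (x * y) = σ y * σ x)
    (hσ_inv : ∀ x, σ (σ x) = x)
    (hσ_smul : ∀ (α : K) (x : B), σ (α • x) = bar α • σ x) :
    ∀ g : B, g ≠ 0 →
      ∃ z s : B, σ s = s ∧ z ≠ 0 ∧ z * σ z = σ z * z ∧ g = z * s := by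
  have : Module.Finite k K := Module.finite_of_finrank_pos (by omega)
  have : Module.Finite K B := Module.finite_of_finrank_pos (by omega)
  have : Module.Finite k B := Module.Finite.trans K B
  have hB : Module.finrank k B = 18 := by
    rw [← Module.finrank_mul_finrank k K B, hK2, hB9]
  obtain ⟨θ, hθ⟩ := hbar_ne
  have hθ' : θ - bar θ ≠ 0 := sub_ne_zero.mpr (Ne.symm hθ)
  have hσk : ∀ (c : k) (x : B), σ (c • x) = c • σ x := fun c x => by
    rw [← algebraMap_smul K c x, hσ_smul, bar.commutes, algebraMap_smul]
  let σl : B →ₗ[k] B := { toFun := σ, map_add' := hσ_add, map_smul' := hσk }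
  have hσl : ∀ x, σl x = σ x := fun _ => rfl
  have hσ1 : σ 1 = 1 := by simpa [hσ_inv] using (hσ_mul (σ 1) 1).symm
  let S : Submodule k B := LinearMap.eqLocus σl LinearMap.id
  have hS : ∀ x, x ∈ S ↔ σ x = x := fun _ => Iff.rfl
  have htr : ∀ x, x + σ x ∈ S := fun x => by
    rw [hS, hσ_add, hσ_inv, add_comm]
  let T : B →ₗ[k] S := LinearMap.codRestrict S (LinearMap.id + σl) htr
  have hT : ∀ x, (T x : B) = x + σ x := fun _ => rfl
  let lθ : B →ₗ[k] B := LinearMap.restrictScalars k (LinearMap.lsmul K B θ)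
  have hlθ : ∀ x, lθ x = θ • x := fun _ => rfl
  have hS9 : 18 ≤ 2 * Module.finrank k S := by
    have hinj : Function.Injective (T.prod (T.comp lθ)) := by
      rw [← LinearMap.ker_eq_bot, LinearMap.ker_eq_bot']
      intro x hx
      have h1 : x + σ x = 0 := by
        rw [← hT]; exact congrArg (fun p => (p.1 : B)) hx
      have h2 : θ • x + σ (θ • x) = 0 := by
        rw [← hlθ, ← hT]; exact congrArg (fun p => (p.2 : B)) hx
      rw [hσ_smul, eq_neg_of_add_eq_zero_right h1, smul_neg, ← sub_eq_add_neg, ← sub_smul] at h2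
      exact (smul_eq_zero.mp h2).resolve_left hθ'
    have := LinearMap.finrank_le_finrank_of_injective hinj
    rw [hB, Module.finrank_prod] at this
    omega
  intro g hg
  let F : (S × S) × k →ₗ[k] B :=
    ((LinearMap.mulRight k g⁻¹ ∘ₗ S.subtype).coprod (-S.subtype)).coprod
      (-(LinearMap.toSpanSingleton k B (θ • (1 : B))))
  have hker : LinearMap.ker F ≠ ⊥ := by
    apply LinearMap.ker_ne_bot_of_finrank_lt
    rw [hB, Module.finrank_prod, Module.finrank_prod, Module.finrank_self]
    omega
  obtain ⟨⟨⟨a, b⟩, c⟩, hF, hne⟩ := Submodule.exists_mem_ne_zero_of_ne_bot hker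
  have hFe : (a : B) * g⁻¹ = b + c • θ • (1 : B) := by
    have h : (a : B) * g⁻¹ + -(b : B) + -(c • θ • (1 : B)) = 0 := hF
    rw [← sub_eq_zero, ← h]; abel
  have hσy : σ (b + c • θ • (1 : B)) = b + c • bar θ • (1 : B) := by
    rw [hσ_add, hσk, hσ_smul, hσ1, (hS _).mp b.2]
  have hy : (a : B) * g⁻¹ ≠ 0 := by
    intro h0
    have ha : a = 0 := by
      have := (mul_eq_zero.mp h0).resolve_right (inv_ne_zero hg)
      exact Subtype.ext this
    rw [hFe] at h0
    have h1 : (b : B) + c • bar θ • (1 : B) = 0 := by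
      rw [← hσy, h0]; exact map_zero σl
    have h2 : c • (θ - bar θ) • (1 : B) = 0 := by
      rw [sub_smul, smul_sub, ← add_sub_add_left_eq_sub _ _ (b : B), h0, h1, sub_zero]
    have hc : c = 0 :=
      (smul_eq_zero.mp h2).resolve_right (smul_ne_zero hθ' one_ne_zero)
    have hb : b = 0 := by
      apply Subtype.ext
      simpa [hc] using h0
    exact hne (by rw [ha, hb, hc]; rfl)
  have hcomm : Commute ((a : B) * g⁻¹) (σ (a * g⁻¹)) := by
    have hK : ∀ (α : K) (x : B), Commute (α • (1 : B)) x := fun α x =>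
      (Commute.one_left x).smul_left α
    rw [hFe, hσy]
    refine Commute.add_left (Commute.add_right rfl ?_) ?_
    · exact ((hK _ _).symm).smul_right c
    · exact (hK _ _).smul_left c
  have hinv : σ ((a * g⁻¹ : B)⁻¹) = (σ (a * g⁻¹))⁻¹ := by
    apply eq_inv_of_mul_eq_one_left
    rw [← hσ_mul, mul_inv_cancel₀ hy, hσ1]
  refine ⟨((a : B) * g⁻¹)⁻¹, a, a.2, inv_ne_zero hy, ?_, ?_⟩
  · rw [hinv]
    exact (Commute.inv_left₀ (Commute.inv_right₀ hcomm)).eq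
  · have ha : (a : B) ≠ 0 := left_ne_zero_of_mul hy
    rw [mul_inv_rev, inv_inv, mul_assoc, inv_mul_cancel₀ ha, mul_one]
end
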